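/- Fix integers k ≥ 2 and p ≥ 1, let (w_{1,n}, …, w_{p,n}) be independent F_k-valued random variables satisfying radial symmetry, positive drift with drift constant L > 0, and subexponential growth, and fix λ with 0 < λ < L/2. Then with probability going to 1 exponentially fast as n → ∞: each of the 2p elements w_{1,n}^{±1}, …, w_{p,n}^{±1} has length at least ⌊λn⌋, and their ⌊λn⌋-prefixes are pairwise distinct (i.e., the map sending (i, ε) ∈ {1,…,p} × {±1} to the ⌊λn⌋-prefix of w_{i,n}^{ε} is injective). -/

import Mathlib

open MeasureTheory

noncomputable section

/-- Every set of a free group is measurable (discrete σ-algebra). -/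
instance freeGroupMeasurableSpace {α : Type*} : MeasurableSpace (FreeGroup α) := ⊤

/-- The length `|g|` of the reduced word representing `g`. -/
def wlen {k : ℕ} (g : FreeGroup (Fin k)) : ℕ := (FreeGroup.toWord g).length

/-- The reduced word of `g` (if `ε = true`) or of `g⁻¹` (if `ε = false`). -/
def signedWord {k : ℕ} (g : FreeGroup (Fin k)) (ε : Bool) : List (Fin k × Bool) :=
  FreeGroup.toWord (if ε then g else g⁻¹)

/-- A family of "failure probabilities" decays exponentially: the corresponding events
hold with probability going to 1 exponentially fast as `n → ∞`. -/
def ExpDecay (f : ℕ → ENNReal) : Prop :=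
  ∃ C : ℝ, 0 < C ∧ ∃ κ : ℝ, 1 < κ ∧ ∀ n : ℕ, f n ≤ ENNReal.ofReal (C / κ ^ n)

/-! ### Radially symmetric measures -/

lemma wlen_inv {k : ℕ} (g : FreeGroup (Fin k)) : wlen g⁻¹ = wlen g := by
  simp [wlen, FreeGroup.toWord_inv]

lemma wlen_mk_of_isReduced {k : ℕ} {W : List (Fin k × Bool)} (h : FreeGroup.IsReduced W) :
    wlen (FreeGroup.mk W) = W.length := by
  rw [wlen, FreeGroup.toWord_mk, h.reduce_eq]

instance freeGroup_countable {k : ℕ} : Countable (FreeGroup (Fin k)) :=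
  FreeGroup.toWord_injective.countable

instance freeGroup_discreteMeasurableSpace {k : ℕ} :
    DiscreteMeasurableSpace (FreeGroup (Fin k)) :=
  ⟨fun _ => trivial⟩

/-- A radially symmetric measure is preserved by injective length-preserving maps. -/
lemma measure_image_of_radial {k : ℕ} {ν : Measure (FreeGroup (Fin k))}
    (hν : ∀ g g' : FreeGroup (Fin k), wlen g = wlen g' → ν {g} = ν {g'})
    {S : Set (FreeGroup (Fin k))} {φ : FreeGroup (Fin k) → FreeGroup (Fin k)}
    (hφ : Set.InjOn φ S) (hlen : ∀ g ∈ S, wlen (φ g) = wlen g) :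
    ν (φ '' S) = ν S := by
  have hS : ν S = ∑' g : S, ν {g.1} := by
    rw [← measure_biUnion S.to_countable (fun a _ b _ hab => by simpa using hab)
      (fun _ _ => .of_discrete), Set.biUnion_of_singleton]
  have himage : ν (φ '' S) = ∑' g : S, ν {φ g.1} := by
    rw [← measure_biUnion (f := fun g => {φ g}) S.to_countable
      (fun a ha b hb hab => Set.disjoint_singleton.2 fun h => hab (hφ ha hb h))
      (fun _ _ => .of_discrete), ← Set.image_eq_iUnion]
  rw [hS, himage]
  exact tsum_congr fun g => hν _ _ (hlen g g.2)

/-- Prepend to a word letters with bases given by `f` and with the sign of its first letter. -/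
def prependSameSign {α : Type*} {r : ℕ} (f : Fin r → α) :
    List (α × Bool) → List (α × Bool)
  | [] => []
  | a :: W => List.ofFn (fun i => (f i, a.2)) ++ a :: W

lemma isReduced_prependSameSign {α : Type*} {r : ℕ} (f : Fin r → α) {W : List (α × Bool)}
    (hW : FreeGroup.IsReduced W) : FreeGroup.IsReduced (prependSameSign f W) := by
  cases W with
  | nil => exact hW
  | cons a W =>
    refine List.isChain_append.2 ⟨?_, hW, ?_⟩
    · refine List.Pairwise.isChain (List.pairwise_ofFn.2 ?_)
      simp
    · intro x hx y hy _
      obtain ⟨i, rfl⟩ := (List.mem_ofFn' _ _).1 (List.mem_of_mem_getLast? hx)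
      simp at hy
      simp [← hy]

lemma length_prependSameSign {α : Type*} {r : ℕ} (f : Fin r → α) {W : List (α × Bool)}
    (hW : W ≠ []) : (prependSameSign f W).length = r + W.length := by
  cases W with
  | nil => exact absurd rfl hW
  | cons a W => simp [prependSameSign]

lemma prependSameSign_inj {α : Type*} {r : ℕ} {f f' : Fin r → α} {W W' : List (α × Bool)}
    (hW : W ≠ []) (hW' : W' ≠ []) (h : prependSameSign f W = prependSameSign f' W') :
    f = f' ∧ W = W' := by
  cases W with
  | nil => exact absurd rfl hW
  | cons a W =>
    cases W' with
    | nil => exact absurd rfl hW'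
    | cons a' W' =>
      obtain ⟨h1, h2⟩ := List.append_inj h (by simp)
      refine ⟨?_, h2⟩
      have h3 := List.ofFn_injective h1
      funext i
      exact congrArg Prod.fst (congrFun h3 i)

/-- If the words of the elements of `S` are determined by what remains after deleting the first
`r` letters, then `S` has small mass for every radially symmetric probability measure. -/
lemma measure_mul_pow_le_one {k : ℕ} {ν : Measure (FreeGroup (Fin k))} [IsProbabilityMeasure ν]
    (hν : ∀ g g' : FreeGroup (Fin k), wlen g = wlen g' → ν {g} = ν {g'})
    {S : Set (FreeGroup (Fin k))} {r : ℕ} (hr : ∀ g ∈ S, r < wlen g)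
    (hS : ∀ g ∈ S, ∀ g' ∈ S, g.toWord.drop r = g'.toWord.drop r → g = g') :
    (k : ENNReal) ^ r * ν S ≤ 1 := by
  let φ : (Fin r → Fin k) → FreeGroup (Fin k) → FreeGroup (Fin k) :=
    fun f g => FreeGroup.mk (prependSameSign f (g.toWord.drop r))
  have hne : ∀ g ∈ S, g.toWord.drop r ≠ [] := fun g hg h => by
    have := hr g hg
    rw [List.drop_eq_nil_iff] at h
    exact absurd this (not_lt.2 h)
  have hred : ∀ (f : Fin r → Fin k) (g : FreeGroup (Fin k)),
      FreeGroup.IsReduced (prependSameSign f (g.toWord.drop r)) := fun f g =>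
    isReduced_prependSameSign f (FreeGroup.isReduced_toWord.infix (List.drop_suffix _ _).isInfix)
  have hinj : ∀ f f' : Fin r → Fin k, ∀ g ∈ S, ∀ g' ∈ S, φ f g = φ f' g' → f = f' ∧ g = g' := by
    intro f f' g hg g' hg' h
    have h := congrArg FreeGroup.toWord h
    simp only [φ, FreeGroup.toWord_mk, (hred _ _).reduce_eq] at h
    obtain ⟨h1, h2⟩ := prependSameSign_inj (hne g hg) (hne g' hg') h
    exact ⟨h1, hS g hg g' hg' h2⟩
  have himage : ∀ f, ν (φ f '' S) = ν S := fun f =>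
    measure_image_of_radial hν (fun g hg g' hg' h => (hinj f f g hg g' hg' h).2) fun g hg => by
      have := hr g hg
      rw [wlen_mk_of_isReduced (hred f g), length_prependSameSign f (hne g hg), List.length_drop]
      simp only [wlen] at this ⊢
      omega
  calc (k : ENNReal) ^ r * ν S = ∑ f, ν (φ f '' S) := by simp [himage]
    _ = ν (⋃ f, φ f '' S) := by
      rw [measure_iUnion _ fun _ => .of_discrete, tsum_fintype]
      intro f f' hff'
      refine Set.disjoint_left.2 ?_
      rintro _ ⟨g, hg, rfl⟩ ⟨g', hg', h⟩
      exact hff' (hinj f' f g' hg' g hg h).1.symm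
    _ ≤ 1 := prob_le_one

lemma measure_le_half_pow {k : ℕ} (hk : 2 ≤ k) {ν : Measure (FreeGroup (Fin k))}
    [IsProbabilityMeasure ν]
    (hν : ∀ g g' : FreeGroup (Fin k), wlen g = wlen g' → ν {g} = ν {g'})
    {S : Set (FreeGroup (Fin k))} {r : ℕ} (hr : ∀ g ∈ S, r < wlen g)
    (hS : ∀ g ∈ S, ∀ g' ∈ S, g.toWord.drop r = g'.toWord.drop r → g = g') :
    ν S ≤ (2⁻¹ : ENNReal) ^ r := by
  rw [← ENNReal.inv_pow, ENNReal.le_inv_iff_mul_le, mul_comm]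
  refine le_trans ?_ (measure_mul_pow_le_one hν hr hS)
  gcongr
  exact_mod_cast hk

lemma signedWord_inv {k : ℕ} (g : FreeGroup (Fin k)) (ε : Bool) :
    signedWord g⁻¹ ε = signedWord g (!ε) := by
  cases ε <;> simp [signedWord]

/-- The mass of the cylinder of elements whose signed word starts with a given word. -/
lemma measure_cylinder_le {k : ℕ} (hk : 2 ≤ k) {ν : Measure (FreeGroup (Fin k))}
    [IsProbabilityMeasure ν]
    (hν : ∀ g g' : FreeGroup (Fin k), wlen g = wlen g' → ν {g} = ν {g'})
    (r : ℕ) (ε : Bool) (u : List (Fin k × Bool)) :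
    ν {g | r < wlen g ∧ (signedWord g ε).take (r + 1) = u} ≤ (2⁻¹ : ENNReal) ^ r := by
  have hpos : ν {g | r < wlen g ∧ (signedWord g true).take (r + 1) = u} ≤ (2⁻¹ : ENNReal) ^ r := by
    refine measure_le_half_pow hk hν (fun g hg => hg.1) ?_
    rintro g ⟨-, hg⟩ g' ⟨-, hg'⟩ h
    apply FreeGroup.toWord_injective
    rw [← List.take_append_drop r g.toWord, ← List.take_append_drop r g'.toWord, h]
    have h1 := congrArg (List.take r) (hg.trans hg'.symm)
    simp only [List.take_take, signedWord, if_true] at h1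
    simp only [Nat.le_succ, min_eq_left] at h1
    rw [h1]
  cases ε with
  | true => exact hpos
  | false =>
    rw [← measure_image_of_radial hν (inv_injective.injOn) (fun g _ => wlen_inv g)] at hpos
    refine le_trans (measure_mono ?_) hpos
    rintro g ⟨hg, hu⟩
    exact ⟨g⁻¹, ⟨by rwa [wlen_inv], by rwa [signedWord_inv]⟩, inv_inv g⟩

/-- The mass of the elements that share a long prefix with their inverse. -/
lemma measure_prefix_eq_inv_le {k : ℕ} (hk : 2 ≤ k) {ν : Measure (FreeGroup (Fin k))}
    [IsProbabilityMeasure ν]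
    (hν : ∀ g g' : FreeGroup (Fin k), wlen g = wlen g' → ν {g} = ν {g'}) (r : ℕ) :
    ν {g | 2 * (r + 1) ≤ wlen g ∧
      (signedWord g true).take (r + 1) = (signedWord g false).take (r + 1)} ≤
      (2⁻¹ : ENNReal) ^ r := by
  refine measure_le_half_pow hk hν (fun g hg => by have := hg.1; omega) ?_
  have key : ∀ g : FreeGroup (Fin k), 2 * (r + 1) ≤ wlen g →
      (signedWord g true).take (r + 1) = (signedWord g false).take (r + 1) →
      g.toWord.take (r + 1) = (FreeGroup.invRev (g.toWord.drop r)).take (r + 1) := by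
    intro g hg h
    have hsplit : FreeGroup.invRev g.toWord =
        FreeGroup.invRev (g.toWord.drop r) ++ FreeGroup.invRev (g.toWord.take r) := by
      rw [← FreeGroup.invRev_append, List.take_append_drop]
    simp only [signedWord, if_true, Bool.false_eq_true, if_false, FreeGroup.toWord_inv] at h
    rw [h, hsplit, List.take_append_of_le_length]
    rw [FreeGroup.invRev_length, List.length_drop]
    simp only [wlen] at hg
    omega
  rintro g ⟨hlen, hg⟩ g' ⟨hlen', hg'⟩ h
  have h1 : g.toWord.take (r + 1) = g'.toWord.take (r + 1) := by
    rw [key g hlen hg, key g' hlen' hg', h]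
  apply FreeGroup.toWord_injective
  have h2 := congrArg (List.take r) h1
  simp only [List.take_take, Nat.le_succ, min_eq_left] at h2
  rw [← List.take_append_drop r g.toWord, ← List.take_append_drop r g'.toWord, h, h2]

/-! ### Two coordinates of a product measure -/

/-- Bound the mass of a relation between two independent discrete coordinates by a uniform bound
on its sections. -/
lemma measure_pi_le_of_section_le {ι G : Type*} [Fintype ι] [MeasurableSpace G]
    [DiscreteMeasurableSpace G] [Countable G] {μ : ι → Measure G}
    [∀ i, IsProbabilityMeasure (μ i)] {i j : ι} (hij : i ≠ j) (R : G → G → Prop)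
    {c : ENNReal} (hc : ∀ h, μ i {g | R g h} ≤ c) :
    Measure.pi μ {w | R (w i) (w j)} ≤ c := by
  have hind : ProbabilityTheory.IndepFun (fun w : ι → G => w i) (fun w => w j)
      (Measure.pi μ) :=
    (ProbabilityTheory.iIndepFun_pi (X := fun _ x => x) fun _ => aemeasurable_id).indepFun hij
  have hmap : ∀ (l : ι) (S : Set G), Measure.pi μ ((fun w : ι → G => w l) ⁻¹' S) = μ l S :=
    fun l S => (measurePreserving_eval μ l).measure_preimage
      (MeasurableSet.of_discrete).nullMeasurableSet
  have hcover : {w : ι → G | R (w i) (w j)} ⊆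
      ⋃ h, (fun w => w i) ⁻¹' {g | R g h} ∩ (fun w => w j) ⁻¹' {h} := fun w hw => by
    simpa using hw
  calc Measure.pi μ {w | R (w i) (w j)}
      ≤ ∑' h, Measure.pi μ ((fun w => w i) ⁻¹' {g | R g h} ∩ (fun w => w j) ⁻¹' {h}) :=
        (measure_mono hcover).trans (measure_iUnion_le _)
    _ = ∑' h, μ i {g | R g h} * μ j {h} := by
      refine tsum_congr fun h => ?_
      rw [hind.measure_inter_preimage_eq_mul _ _ .of_discrete .of_discrete, hmap, hmap]
    _ ≤ ∑' h, c * μ j {h} := by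
      gcongr with h
      exact hc h
    _ = c := by
      rw [ENNReal.tsum_mul_left, ← measure_iUnion
        (fun a b hab => Set.disjoint_singleton.2 hab) fun _ => .of_discrete,
        Set.iUnion_of_singleton, measure_univ, mul_one]

/-! ### Exponential decay -/

lemma ExpDecay.mono {f g : ℕ → ENNReal} (hg : ExpDecay g) (h : ∀ n, f n ≤ g n) :
    ExpDecay f := by
  obtain ⟨C, hC, κ, hκ, hb⟩ := hg
  exact ⟨C, hC, κ, hκ, fun n => (h n).trans (hb n)⟩

lemma ExpDecay.zero : ExpDecay fun _ => 0 :=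
  ⟨1, one_pos, 2, one_lt_two, fun _ => zero_le⟩

lemma ExpDecay.add {f g : ℕ → ENNReal} (hf : ExpDecay f) (hg : ExpDecay g) :
    ExpDecay fun n => f n + g n := by
  obtain ⟨C, hC, κ, hκ, hf⟩ := hf
  obtain ⟨C', hC', κ', hκ', hg⟩ := hg
  have hpos : 0 < min κ κ' := lt_min (by linarith) (by linarith)
  refine ⟨C + C', by positivity, min κ κ', lt_min hκ hκ', fun n => ?_⟩
  rw [add_div, ENNReal.ofReal_add (by positivity) (by positivity)]
  refine add_le_add ((hf n).trans (ENNReal.ofReal_le_ofReal ?_))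
    ((hg n).trans (ENNReal.ofReal_le_ofReal ?_))
  · gcongr
    exact min_le_left _ _
  · gcongr
    exact min_le_right _ _

lemma ExpDecay.sum {ι : Type*} (s : Finset ι) {f : ι → ℕ → ENNReal}
    (hf : ∀ i, ExpDecay (f i)) : ExpDecay fun n => ∑ i ∈ s, f i n := by
  classical
  induction s using Finset.induction_on with
  | empty => simpa using ExpDecay.zero
  | insert i s hi ih =>
    simp only [Finset.sum_insert hi]
    exact (hf i).add ih

lemma expDecay_half_pow_floor {lam : ℝ} (hlam : 0 < lam) :
    ExpDecay fun n => (2⁻¹ : ENNReal) ^ (Nat.floor (lam * n) - 1) := by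
  refine ⟨4, by norm_num, 2 ^ lam, Real.one_lt_rpow one_lt_two hlam, fun n => ?_⟩
  set m := Nat.floor (lam * n) with hm
  have h2 : (2⁻¹ : ENNReal) = ENNReal.ofReal 2⁻¹ := by
    rw [ENNReal.ofReal_inv_of_pos two_pos]
    simp
  change (2⁻¹ : ENNReal) ^ (m - 1) ≤ _
  rw [h2, ← ENNReal.ofReal_pow (by norm_num)]
  refine ENNReal.ofReal_le_ofReal ?_
  rw [le_div_iff₀ (by positivity), inv_pow, inv_mul_le_iff₀ (by positivity),
    ← Real.rpow_natCast (2 ^ lam), ← Real.rpow_mul two_pos.le]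
  calc (2 : ℝ) ^ (lam * n) ≤ 2 ^ ((m + 1 : ℕ) : ℝ) := by
        refine Real.rpow_le_rpow_of_exponent_le one_le_two ?_
        push_cast
        exact (Nat.lt_floor_add_one _).le
    _ = 2 ^ (m + 1) := Real.rpow_natCast _ _
    _ ≤ 2 ^ ((m - 1) + 2) := pow_le_pow_right₀ one_le_two (by omega)
    _ = 2 ^ (m - 1) * 4 := by rw [pow_add]; norm_num

/-- Two distinct signed coordinates rarely share a long prefix. -/
lemma measure_pi_prefix_eq_le {k p : ℕ} (hk : 2 ≤ k) {μ : Fin p → Measure (FreeGroup (Fin k))}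
    [∀ i, IsProbabilityMeasure (μ i)]
    (hμ : ∀ i (g g' : FreeGroup (Fin k)), wlen g = wlen g' → μ i {g} = μ i {g'})
    (m : ℕ) {q q' : Fin p × Bool} (hq : q ≠ q') :
    Measure.pi μ {w | 2 * m ≤ wlen (w q.1) ∧
      (signedWord (w q.1) q.2).take m = (signedWord (w q'.1) q'.2).take m} ≤
      (2⁻¹ : ENNReal) ^ (m - 1) := by
  cases m with
  | zero => simp
  | succ r =>
    rw [Nat.add_sub_cancel]
    obtain ⟨i, ε⟩ := q
    obtain ⟨j, ε'⟩ := q'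
    by_cases hij : i = j
    · subst hij
      refine le_trans (measure_mono ?_) <|
        ((measurePreserving_eval μ i).measure_preimage
          (MeasurableSet.of_discrete).nullMeasurableSet).trans_le
          (measure_prefix_eq_inv_le hk (hμ i) r)
      rintro w ⟨hlen, hw⟩
      cases ε <;> cases ε'
      · exact absurd rfl hq
      · exact ⟨hlen, hw.symm⟩
      · exact ⟨hlen, hw⟩
      · exact absurd rfl hq
    · refine measure_pi_le_of_section_le hij (fun g h => 2 * (r + 1) ≤ wlen g ∧
        (signedWord g ε).take (r + 1) = (signedWord h ε').take (r + 1)) fun h => ?_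
      refine le_trans (measure_mono ?_) (measure_cylinder_le hk (hμ i) r ε
        ((signedWord h ε').take (r + 1)))
      rintro g ⟨hlen, hg⟩
      exact ⟨by omega, hg⟩

/-- central tree property. `μ n i` is the distribution of `w_{i,n}`;
independence is expressed by the product measure. Under radial symmetry, positive drift
with constant `L`, and subexponential growth, for fixed `0 < λ < L/2`, with probability
going to 1 exponentially fast the `2p` elements `w_{i,n}^{±1}` have length at least
`⌊λn⌋` and pairwise distinct `⌊λn⌋`-prefixes. -/
theorem central_tree_property (k p : ℕ) (hk : 2 ≤ k) (hp : 1 ≤ p)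
    (μ : ℕ → Fin p → Measure (FreeGroup (Fin k)))
    (hprob : ∀ n i, IsProbabilityMeasure (μ n i))
    (hradial : ∀ n i (g g' : FreeGroup (Fin k)), wlen g = wlen g' →
      μ n i {g} = μ n i {g'})
    (L : ℝ) (hL : 0 < L)
    (hdrift : ∀ i, ExpDecay (fun n => μ n i {g | ¬ (L * n < (wlen g : ℝ))}))
    (hsubexp : ∀ θ : ℝ, 0 < θ → ∀ i,
      ExpDecay (fun n => μ n i {g | ¬ ((wlen g : ℝ) ≤ Real.exp (θ * n))}))
    (lam : ℝ) (hlam0 : 0 < lam) (hlamL : lam < L / 2) :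
    ExpDecay (fun n =>
      Measure.pi (μ n)
        {w : Fin p → FreeGroup (Fin k) |
          ¬ ((∀ i : Fin p, Nat.floor (lam * n) ≤ wlen (w i)) ∧
            Function.Injective (fun q : Fin p × Bool =>
              (signedWord (w q.1) q.2).take (Nat.floor (lam * n))))}) := by
  classical
  have hbound : ExpDecay fun n =>
      ∑ i, μ n i {g | ¬ (L * n < (wlen g : ℝ))} +
        ∑ _q ∈ (Finset.univ : Finset ((Fin p × Bool) × (Fin p × Bool))),
          (2⁻¹ : ENNReal) ^ (Nat.floor (lam * n) - 1) :=
    (ExpDecay.sum _ hdrift).add (ExpDecay.sum _ fun _ => expDecay_half_pow_floor hlam0)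
  refine hbound.mono fun n => ?_
  have := hprob n
  set m := Nat.floor (lam * n) with hm
  let B : (Fin p × Bool) × (Fin p × Bool) → Set (Fin p → FreeGroup (Fin k)) := fun q =>
    {w | q.1 ≠ q.2 ∧ 2 * m ≤ wlen (w q.1.1) ∧
      (signedWord (w q.1.1) q.1.2).take m = (signedWord (w q.2.1) q.2.2).take m}
  have hB : ∀ q, Measure.pi (μ n) (B q) ≤ (2⁻¹ : ENNReal) ^ (m - 1) := fun q => by
    by_cases hq : q.1 = q.2
    · simp [B, hq]
    · exact (measure_mono fun w hw => hw.2).trans (measure_pi_prefix_eq_le hk (hradial n) m hq)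
  have hlong : ∀ g : FreeGroup (Fin k), L * n < (wlen g : ℝ) → 2 * m ≤ wlen g := fun g hg => by
    have h1 : (m : ℝ) ≤ lam * n := Nat.floor_le (by positivity)
    have h2 : lam * n ≤ L / 2 * n := by gcongr
    have h3 : ((2 * m : ℕ) : ℝ) ≤ wlen g := by
      push_cast
      linarith
    exact_mod_cast h3
  have hcover : {w : Fin p → FreeGroup (Fin k) |
      ¬ ((∀ i : Fin p, m ≤ wlen (w i)) ∧
        Function.Injective (fun q : Fin p × Bool => (signedWord (w q.1) q.2).take m))} ⊆
      (⋃ i, (fun w => w i) ⁻¹' {g | ¬ (L * n < (wlen g : ℝ))}) ∪ ⋃ q, B q := by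
    intro w hw
    by_contra hcon
    simp only [Set.mem_union, Set.mem_iUnion, not_or, not_exists, Set.mem_preimage,
      Set.mem_ofPred_eq, not_not] at hcon
    obtain ⟨hdr, hBw⟩ := hcon
    refine hw ⟨fun i => ?_, fun q q' hqq' => ?_⟩
    · have := hlong _ (hdr i)
      omega
    · by_contra hne
      exact hBw (q, q') ⟨hne, hlong _ (hdr q.1), hqq'⟩
  refine (measure_mono hcover).trans ((measure_union_le _ _).trans (add_le_add ?_ ?_))
  · refine (measure_iUnion_fintype_le _ _).trans (Finset.sum_le_sum fun i _ => ?_)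
    exact ((measurePreserving_eval (μ n) i).measure_preimage
      (MeasurableSet.of_discrete).nullMeasurableSet).le
  · exact (measure_iUnion_fintype_le _ _).trans (Finset.sum_le_sum fun q _ => hB q)

end
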